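/- arXiv:1111.7214 — 7 statements merged into one kernel-verified Lean document; each statement's English description precedes it below -/
import Mathlib

section
/- Let A be a unital associative ring, G a group, and σ : G → Aut(A) a group homomorphism, with associated skew group ring A ⋊_σ G. If A ⋊_σ G is a simple ring, then: (i) the centre Z(A ⋊_σ G) is a field; (ii) A is G-simple; and (iii) σ : G → Aut(A) is injective. -/
/-- `R`, together with a ring embedding `ι : A →+* R` and a family `u : G → R` of
distinguished elements, is a skew group ring `A ⋊_σ G`: the `u g` satisfy
`u 1 = 1`, `u g * u h = u (g * h)`, the twisted commutation rule
`u g * ι a = ι (σ g a) * u g` (which forces `(a u_g)(b u_h) = a σ_g(b) u_{gh}`),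
and `R` is a free left `A`-module with basis `{u g}_{g ∈ G}`, i.e. every element
of `R` is uniquely a finite sum `∑ a_g u_g`. -/
def IsSkewGroupRing {A G R : Type*} [Ring A] [Group G] [Ring R]
    (σ : G →* RingAut A) (ι : A →+* R) (u : G → R) : Prop :=
  u 1 = 1 ∧
  (∀ g h : G, u g * u h = u (g * h)) ∧
  (∀ (g : G) (a : A), u g * ι a = ι (σ g a) * u g) ∧
  (∀ r : R, ∃! f : G →₀ A, r = f.sum fun g a => ι a * u g)

/-- `A` is `G`-simple: the only `G`-invariant (two-sided) ideals of `A` are `{0}` and `A`. -/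
def IsGSimple {A G : Type*} [Ring A] [Group G] (σ : G →* RingAut A) : Prop :=
  ∀ I : TwoSidedIdeal A, (∀ (g : G) (a : A), a ∈ I → σ g a ∈ I) → I = ⊥ ∨ I = ⊤

namespace IsSkewGroupRing

variable {A G R : Type*} [Ring A] [Group G] [Ring R] {σ : G →* RingAut A} {ι : A →+* R} {u : G → R}

/-- The additive map `(a_g)_g ↦ ∑ τ (a_g) * v g` on finitely supported families. -/
noncomputable def sumHom {A G S : Type*} [Ring A] [Ring S] (τ : A →+* S) (v : G → S) :
    (G →₀ A) →+ S :=
  Finsupp.liftAddHom fun g => (AddMonoidHom.mulRight (v g)).comp τ.toAddMonoidHom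

@[simp]
theorem sumHom_single {A G S : Type*} [Ring A] [Ring S] (τ : A →+* S) (v : G → S) (g : G) (a : A) :
    sumHom τ v (Finsupp.single g a) = τ a * v g := by
  simp [sumHom]

theorem bijective_sumHom (h : IsSkewGroupRing σ ι u) : Function.Bijective (sumHom ι u) := by
  rw [Function.bijective_iff_existsUnique]
  intro r
  obtain ⟨f, hf, huniq⟩ := h.2.2.2 r
  exact ⟨f, hf.symm, fun f' hf' => huniq f' hf'.symm⟩

theorem injective_coeff_mul (h : IsSkewGroupRing σ ι u) {g k : G} {a b : A}
    (hab : ι a * u g = ι b * u k) : Finsupp.single g a = Finsupp.single k b :=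
  h.bijective_sumHom.1 (by simpa using hab)

/-- A skew group ring maps to every ring with a covariant pair of maps from `A` and `G`. -/
theorem exists_lift (h : IsSkewGroupRing σ ι u) {S : Type*} [Ring S] (τ : A →+* S) (v : G →* S)
    (hv : ∀ g a, v g * τ a = τ (σ g a) * v g) :
    ∃ φ : R →+* S, (∀ a, φ (ι a) = τ a) ∧ ∀ g, φ (u g) = v g := by
  obtain ⟨hu1, hmul, hcomm, -⟩ := id h
  let E := AddEquiv.ofBijective (sumHom ι u) h.bijective_sumHom
  let φ : R →+ S := (sumHom τ v).comp E.symm.toAddMonoidHom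
  have hφE (f : G →₀ A) : φ (sumHom ι u f) = sumHom τ v f :=
    congrArg (sumHom τ v) (E.symm_apply_apply f)
  have hφ (a : A) (g : G) : φ (ι a * u g) = τ a * v g := by
    simpa using hφE (Finsupp.single g a)
  have hφι (a : A) : φ (ι a) = τ a := by simpa [hu1] using hφ a 1
  have hφu (g : G) : φ (u g) = v g := by simpa using hφ 1 g
  have hφmul (x y : R) : φ (x * y) = φ x * φ y := by
    obtain ⟨f, rfl⟩ := h.bijective_sumHom.2 x
    obtain ⟨f', rfl⟩ := h.bijective_sumHom.2 y
    induction f using Finsupp.induction_linear with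
    | zero => simp
    | add f₁ f₂ h₁ h₂ => simp only [map_add, add_mul, h₁, h₂]
    | single g a =>
      induction f' using Finsupp.induction_linear with
      | zero => simp
      | add f₁ f₂ h₁ h₂ => simp only [map_add, mul_add, h₁, h₂]
      | single k b =>
        have hR : ι a * u g * (ι b * u k) = ι (a * σ g b) * u (g * k) := by
          rw [map_mul, ← hmul, mul_assoc, ← mul_assoc (u g), hcomm]
          simp only [mul_assoc]
        have hS : τ a * v g * (τ b * v k) = τ (a * σ g b) * v (g * k) := by
          rw [map_mul, map_mul, mul_assoc, ← mul_assoc (v g), hv]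
          simp only [mul_assoc]
        simp only [sumHom_single, hR, hφ, hS]
  exact ⟨{ φ with
    map_one' := by simpa using hφι 1
    map_mul' := hφmul }, hφι, hφu⟩

theorem injective_baseHom (h : IsSkewGroupRing σ ι u) : Function.Injective ι := by
  intro a b hab
  exact Finsupp.single_injective (1 : G) (h.injective_coeff_mul (by rw [hab]))

theorem injective_unit (h : IsSkewGroupRing σ ι u) [Nontrivial A] : Function.Injective u := by
  intro g k hgk
  exact (Finsupp.single_left_inj one_ne_zero).1
    (h.injective_coeff_mul (a := (1 : A)) (b := 1) (by rw [hgk]))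

theorem nontrivial_addMonoidEnd (M : Type*) [AddCommMonoid M] [Nontrivial M] :
    Nontrivial (AddMonoid.End M) := by
  obtain ⟨m, hm⟩ := exists_ne (0 : M)
  exact ⟨1, 0, fun h10 => hm (DFunLike.congr_fun h10 m)⟩

theorem isGSimple (h : IsSkewGroupRing σ ι u) [IsSimpleRing R] : IsGSimple σ := by
  intro I hI
  refine or_iff_not_imp_right.2 fun htop => ?_
  let Q := I.ringCon.Quotient
  have : Nontrivial Q := by
    refine ⟨1, 0, fun h10 => htop ?_⟩
    exact I.one_mem_iff.1 ((I.mem_iff 1).2 (I.ringCon.eq.1 h10))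
  let s (g : G) : Q →+* Q := I.ringCon.lift (I.ringCon.mk'.comp (σ g : A →+* A)) fun a b hab =>
    I.ringCon.eq.2 <| by
      rw [TwoSidedIdeal.rel_iff] at hab ⊢
      simpa using hI g _ hab
  have hs (g : G) (a : A) : s g (I.ringCon.mk' a) = I.ringCon.mk' (σ g a) := rfl
  let v : G →* AddMonoid.End Q :=
    { toFun g := (s g).toAddMonoidHom
      map_one' := by
        ext q
        obtain ⟨a, rfl⟩ := I.ringCon.mk'_surjective q
        exact (hs 1 a).trans (by simp)
      map_mul' g k := by
        ext q
        obtain ⟨a, rfl⟩ := I.ringCon.mk'_surjective q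
        exact congrArg I.ringCon.mk' (DFunLike.congr_fun (map_mul σ g k) a) }
  obtain ⟨φ, hφ, -⟩ := h.exists_lift ((Module.toAddMonoidEnd Q Q).comp I.ringCon.mk') v
    fun g a => by
      ext q
      exact map_mul (s g) (I.ringCon.mk' a) q
  have := nontrivial_addMonoidEnd Q
  refine le_bot_iff.1 fun a ha => ?_
  have ha0 : I.ringCon.mk' a = 0 := I.ringCon.eq.2 ((I.mem_iff a).1 ha)
  have hιa : ι a = 0 := φ.injective (by rw [hφ, RingHom.comp_apply, ha0, map_zero, map_zero])
  exact (TwoSidedIdeal.mem_bot A).2 (h.injective_baseHom (by rw [hιa, map_zero]))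

theorem injective_action (h : IsSkewGroupRing σ ι u) [IsSimpleRing R] : Function.Injective σ := by
  have : Nontrivial A := ι.domain_nontrivial
  let v : G →* AddMonoid.End A :=
    { toFun g := (σ g : A →+* A).toAddMonoidHom
      map_one' := by ext; simp; rfl
      map_mul' g k := by ext; simp; rfl }
  obtain ⟨φ, -, hφ⟩ := h.exists_lift (Module.toAddMonoidEnd A A) v
    fun g a => by
      ext b
      exact map_mul (σ g) a b
  have := nontrivial_addMonoidEnd A
  intro g k hgk
  refine h.injective_unit (φ.injective ?_)
  rw [hφ, hφ]
  exact congrArg (fun s : RingAut A => (s : A →+* A).toAddMonoidHom) hgk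

end IsSkewGroupRing

/-- **Proposition 3.1.** If a skew group ring `A ⋊_σ G` is simple, then (i) its centre is a
field, (ii) `A` is `G`-simple, and (iii) `σ : G → Aut(A)` is injective. -/
theorem necessary_conditions_for_simplicity {A G R : Type*} [Ring A] [Group G] [Ring R]
    (σ : G →* RingAut A) (ι : A →+* R) (u : G → R)
    (h : IsSkewGroupRing σ ι u) (hsimple : IsSimpleRing R) :
    IsField (Subring.center R) ∧ IsGSimple σ ∧ Function.Injective σ :=
  ⟨IsSimpleRing.isField_center R, h.isGSimple, h.injective_action⟩
end

section
/- Let R = A ⋊_σ G be a skew group ring where G is an abelian group and A is G-simple. For each non-zero r ∈ R there exists r' ∈ R such that: (i) r' belongs to the two-sided ideal RrR generated by r; (ii) E(r') = 1, where E(∑_g a_g u_g) = a_e; and (iii) |Supp(r')| ≤ |Supp(r)|. -/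
/-- For a finite set `S` of an abelian group `G` and a two-sided ideal `K` of the skew group
ring `R`, the coefficients at `1` of those elements of `K` supported in `S` form a two-sided
ideal of `A`. -/
def coeffOneIdeal {A G R : Type*} [Ring A] [CommGroup G] [Ring R]
    (σ : G →* RingAut A) (ι : A →+* R) (u : G → R)
    (hcomm : ∀ (g : G) (a : A), u g * ι a = ι (σ g a) * u g)
    (K : TwoSidedIdeal R) (S : Finset G) : TwoSidedIdeal A :=
  TwoSidedIdeal.mk' {a | ∃ c : G → A, c 1 = a ∧ ∑ g ∈ S, ι (c g) * u g ∈ K}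
    ⟨0, rfl, by simp⟩
    (by
      rintro _ _ ⟨c, rfl, hc⟩ ⟨d, rfl, hd⟩
      exact ⟨c + d, rfl, by
        simpa [add_mul, Finset.sum_add_distrib] using K.add_mem hc hd⟩)
    (by
      rintro _ ⟨c, rfl, hc⟩
      exact ⟨-c, rfl, by simpa using K.neg_mem hc⟩)
    (by
      rintro b _ ⟨c, rfl, hc⟩
      exact ⟨fun g => b * c g, rfl, by
        simpa [Finset.mul_sum, mul_assoc] using K.mul_mem_left (ι b) _ hc⟩)
    (by
      rintro _ b ⟨c, rfl, hc⟩
      exact ⟨fun g => c g * σ g b, by simp, by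
        simpa [Finset.sum_mul, mul_assoc, hcomm] using K.mul_mem_right _ (ι b) hc⟩)

theorem mem_coeffOneIdeal {A G R : Type*} [Ring A] [CommGroup G] [Ring R]
    {σ : G →* RingAut A} {ι : A →+* R} {u : G → R}
    {hcomm : ∀ (g : G) (a : A), u g * ι a = ι (σ g a) * u g}
    {K : TwoSidedIdeal R} {S : Finset G} {a : A} :
    a ∈ coeffOneIdeal σ ι u hcomm K S ↔
      ∃ c : G → A, c 1 = a ∧ ∑ g ∈ S, ι (c g) * u g ∈ K :=
  TwoSidedIdeal.mem_mk' _ _ _ _ _ _ _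

theorem map_mem_coeffOneIdeal {A G R : Type*} [Ring A] [CommGroup G] [Ring R]
    {σ : G →* RingAut A} {ι : A →+* R} {u : G → R}
    (hmul : ∀ g h : G, u g * u h = u (g * h))
    {hcomm : ∀ (g : G) (a : A), u g * ι a = ι (σ g a) * u g}
    {K : TwoSidedIdeal R} {S : Finset G} (g : G) {a : A}
    (ha : a ∈ coeffOneIdeal σ ι u hcomm K S) :
    σ g a ∈ coeffOneIdeal σ ι u hcomm K S := by
  obtain ⟨c, rfl, hc⟩ := mem_coeffOneIdeal.1 ha
  refine mem_coeffOneIdeal.2 ⟨fun k => σ g (c k), rfl, ?_⟩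
  have hconj := K.mul_mem_right _ (u g⁻¹) (K.mul_mem_left (u g) _ hc)
  rw [Finset.mul_sum, Finset.sum_mul] at hconj
  convert hconj using 2 with k
  rw [← mul_assoc, hcomm, mul_assoc, mul_assoc, hmul, hmul, mul_comm k, mul_inv_cancel_left]

/-- **Lemma 4.1.** Let `R = A ⋊_σ G` be a skew group ring with `G` abelian and `A`
`G`-simple. For each non-zero `r ∈ R` there is `r' ∈ RrR` (the two-sided ideal generated
by `r`) with `E(r') = 1` (its coefficient at the neutral element is `1`) and
`|Supp(r')| ≤ |Supp(r)|`. -/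
theorem exists_good_element_in_ideal {A G R : Type*} [Ring A] [CommGroup G] [Ring R]
    (σ : G →* RingAut A) (ι : A →+* R) (u : G → R)
    (h : IsSkewGroupRing σ ι u) (hGsimple : IsGSimple σ)
    (r : R) (hr : r ≠ 0) (f : G →₀ A) (hf : r = f.sum fun g a => ι a * u g) :
    ∃ r' : R, r' ∈ TwoSidedIdeal.span {r} ∧
      ∃ f' : G →₀ A, r' = (f'.sum fun g a => ι a * u g) ∧
        f' 1 = 1 ∧ f'.support.card ≤ f.support.card := by
  classical
  obtain ⟨-, hmul, hcomm, -⟩ := h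
  have hf0 : f ≠ 0 := by
    rintro rfl
    exact hr (by simpa using hf)
  obtain ⟨k, hk⟩ := Finsupp.support_nonempty_iff.2 hf0
  let S := f.support.image (· * k⁻¹)
  have hS : (1 : G) ∈ S := Finset.mem_image.2 ⟨k, hk, mul_inv_cancel k⟩
  have hfk : f k ∈ coeffOneIdeal σ ι u hcomm (TwoSidedIdeal.span {r}) S := by
    refine mem_coeffOneIdeal.2 ⟨fun g => f (g * k), by simp, ?_⟩
    have hmem := (TwoSidedIdeal.span {r}).mul_mem_right _ (u k⁻¹)
      (TwoSidedIdeal.subset_span (Set.mem_singleton r))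
    rw [Finset.sum_image (mul_left_injective k⁻¹).injOn]
    convert hmem using 1
    rw [hf, Finsupp.sum, Finset.sum_mul]
    simp [mul_assoc, hmul]
  have htop : coeffOneIdeal σ ι u hcomm (TwoSidedIdeal.span {r}) S = ⊤ := by
    refine (hGsimple _ fun g a ha => map_mem_coeffOneIdeal hmul g ha).resolve_left fun hbot => ?_
    rw [hbot, TwoSidedIdeal.mem_bot] at hfk
    exact Finsupp.mem_support_iff.1 hk hfk
  obtain ⟨c, hc1, hc⟩ := mem_coeffOneIdeal.1 (htop ▸ TwoSidedIdeal.mem_top (x := (1 : A)))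
  refine ⟨_, hc, Finsupp.indicator S fun g _ => c g, ?_, ?_, ?_⟩
  · rw [Finsupp.sum_of_support_subset _ (Finsupp.support_indicator_subset _ _) _ (by simp)]
    exact Finset.sum_congr rfl fun g hg => by rw [Finsupp.indicator_of_mem hg]
  · rw [Finsupp.indicator_of_mem hS, hc1]
  · exact (Finset.card_le_card (Finsupp.support_indicator_subset _ _)).trans
      Finset.card_image_le
end

section
/- Let R = A ⋊_σ G be a skew group ring where G is an abelian group and A is G-simple. Then every non-zero (two-sided) ideal of R has non-empty intersection with Z(R) ∩ (1 + ∑_{g∈G∖{e}} A u_g). In particular, the centre Z(R) has the ideal intersection property in R, i.e. Z(R) ∩ I ≠ {0} for every non-zero ideal I of R. -/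
namespace IsSkewGroupRing

section Basis

variable {A G R : Type*} [Ring A] [Ring R] {ι : A →+* R} {u : G → R}

/-- The additive map sending a finitely supported family `f` to `∑ f_g u_g`. -/
noncomputable def ofCoeff (ι : A →+* R) (u : G → R) : (G →₀ A) →+ R :=
  Finsupp.liftAddHom fun g => (AddMonoidHom.mulRight (u g)).comp ι.toAddMonoidHom

theorem ofCoeff_single (g : G) (a : A) :
    ofCoeff ι u (Finsupp.single g a) = ι a * u g := by
  simp [ofCoeff]

end Basis

section Group

variable {A G R : Type*} [Ring A] [Group G] [Ring R]
  {σ : G →* RingAut A} {ι : A →+* R} {u : G → R}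

theorem u_one (h : IsSkewGroupRing σ ι u) : u 1 = 1 := h.1

theorem u_mul (h : IsSkewGroupRing σ ι u) (g k : G) : u g * u k = u (g * k) := h.2.1 g k

theorem u_mul_ι (h : IsSkewGroupRing σ ι u) (g : G) (a : A) :
    u g * ι a = ι (σ g a) * u g := h.2.2.1 g a

theorem ofCoeff_bijective (h : IsSkewGroupRing σ ι u) :
    Function.Bijective (ofCoeff ι u) := by
  refine ⟨fun f f' hf => ?_, fun r => ?_⟩
  · exact (h.2.2.2 (ofCoeff ι u f)).unique rfl hf
  · obtain ⟨f, hf, -⟩ := h.2.2.2 r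
    exact ⟨f, hf.symm⟩

/-- The coefficients of an element of a skew group ring with respect to the basis `u`. -/
noncomputable def coeff (h : IsSkewGroupRing σ ι u) : R ≃+ (G →₀ A) :=
  (AddEquiv.ofBijective (ofCoeff ι u) h.ofCoeff_bijective).symm

theorem ofCoeff_coeff (h : IsSkewGroupRing σ ι u) (x : R) : ofCoeff ι u (h.coeff x) = x :=
  (AddEquiv.ofBijective (ofCoeff ι u) h.ofCoeff_bijective).apply_symm_apply x

theorem coeff_ι_mul_u (h : IsSkewGroupRing σ ι u) (a : A) (g : G) :
    h.coeff (ι a * u g) = Finsupp.single g a := by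
  rw [← ofCoeff_single]
  exact (AddEquiv.ofBijective (ofCoeff ι u) h.ofCoeff_bijective).symm_apply_apply _

theorem induction_on (h : IsSkewGroupRing σ ι u) {p : R → Prop} (x : R) (zero : p 0)
    (add : ∀ x y, p x → p y → p (x + y)) (single : ∀ a g, p (ι a * u g)) : p x := by
  rw [← h.ofCoeff_coeff x]
  induction h.coeff x using Finsupp.induction_linear with
  | zero => simpa using zero
  | add f f' hf hf' => simpa using add _ _ hf hf'
  | single g a => simpa [ofCoeff_single] using single a g

theorem coeff_ι_mul (h : IsSkewGroupRing σ ι u) (a : A) (x : R) (g : G) :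
    h.coeff (ι a * x) g = a * h.coeff x g := by
  induction x using h.induction_on with
  | zero => simp
  | add x y hx hy => simp [mul_add, hx, hy]
  | single b k =>
    classical
    rw [← mul_assoc, ← map_mul, coeff_ι_mul_u, coeff_ι_mul_u, Finsupp.single_apply,
      Finsupp.single_apply, mul_ite, mul_zero]

theorem coeff_mul_ι (h : IsSkewGroupRing σ ι u) (a : A) (x : R) (g : G) :
    h.coeff (x * ι a) g = h.coeff x g * σ g a := by
  induction x using h.induction_on with
  | zero => simp
  | add x y hx hy => simp [add_mul, hx, hy]
  | single b k =>
    classical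
    rw [mul_assoc, h.u_mul_ι, ← mul_assoc, ← map_mul, coeff_ι_mul_u, coeff_ι_mul_u,
      Finsupp.single_apply, Finsupp.single_apply]
    split_ifs with hk <;> simp [hk]

theorem coeff_mul_u (h : IsSkewGroupRing σ ι u) (k : G) (x : R) (g : G) :
    h.coeff (x * u k) g = h.coeff x (g * k⁻¹) := by
  induction x using h.induction_on with
  | zero => simp
  | add x y hx hy => simp [add_mul, hx, hy]
  | single b l =>
    classical
    rw [mul_assoc, h.u_mul, coeff_ι_mul_u, coeff_ι_mul_u, Finsupp.single_apply,
      Finsupp.single_apply]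
    simp only [eq_mul_inv_iff_mul_eq]

theorem coeff_u_mul (h : IsSkewGroupRing σ ι u) (k : G) (x : R) (g : G) :
    h.coeff (u k * x) g = σ k (h.coeff x (k⁻¹ * g)) := by
  induction x using h.induction_on with
  | zero => simp
  | add x y hx hy => simp [mul_add, hx, hy]
  | single b l =>
    classical
    rw [← mul_assoc, h.u_mul_ι, mul_assoc, h.u_mul, coeff_ι_mul_u, coeff_ι_mul_u,
      Finsupp.single_apply, Finsupp.single_apply, apply_ite (σ k), map_zero]
    simp only [eq_inv_mul_iff_mul_eq]

theorem mem_center (h : IsSkewGroupRing σ ι u) {z : R} (hι : ∀ a, Commute (ι a) z)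
    (hu : ∀ g, Commute (u g) z) : z ∈ Subring.center R := by
  rw [Subring.mem_center_iff]
  intro x
  change Commute x z
  induction x using h.induction_on with
  | zero => exact Commute.zero_left z
  | add x y hx hy => exact hx.add_left hy
  | single a g => exact (hι a).mul_left (hu g)

/-- A non-zero ideal contains a non-zero element of minimal support, which may be translated
so that its support contains the neutral element. -/
theorem exists_minimal_support (h : IsSkewGroupRing σ ι u) {I : TwoSidedIdeal R} (hI : I ≠ ⊥) :
    ∃ r ∈ I, h.coeff r 1 ≠ 0 ∧
      ∀ x ∈ I, x ≠ 0 → (h.coeff r).support.card ≤ (h.coeff x).support.card := by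
  obtain ⟨y, hyI, hy⟩ : ∃ y ∈ I, y ≠ 0 := by
    contrapose! hI
    exact le_antisymm (fun y hy => (TwoSidedIdeal.mem_bot R).2 (hI y hy)) bot_le
  obtain ⟨r, ⟨hrI, hr⟩, hmin⟩ := exists_minimalFor_of_wellFoundedLT
    (fun x => x ∈ I ∧ x ≠ 0) (fun x => (h.coeff x).support.card) ⟨y, hyI, hy⟩
  obtain ⟨g, hg⟩ := Finsupp.ne_iff.1 ((map_ne_zero_iff h.coeff h.coeff.injective).2 hr)
  refine ⟨r * u g⁻¹, I.mul_mem_right _ _ hrI, by simpa [coeff_mul_u] using hg,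
    fun x hxI hx => le_trans ?_ ((le_total _ _).elim id fun hle => hmin ⟨hxI, hx⟩ hle)⟩
  refine Finset.card_le_card_of_injOn (· * g) (fun k hk => ?_) (mul_left_injective g).injOn
  simpa [coeff_mul_u] using hk

end Group

section CommGroup

variable {A G R : Type*} [Ring A] [CommGroup G] [Ring R]
  {σ : G →* RingAut A} {ι : A →+* R} {u : G → R}

theorem coeff_conj (h : IsSkewGroupRing σ ι u) (k : G) (x : R) (g : G) :
    h.coeff (u k * x * u k⁻¹) g = σ k (h.coeff x g) := by
  rw [coeff_mul_u, coeff_u_mul, inv_inv, mul_comm g k, inv_mul_cancel_left]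

/-- The coefficients at the neutral element of the members of `I` supported in `S`. -/
noncomputable def coeffIdeal (h : IsSkewGroupRing σ ι u) (I : TwoSidedIdeal R) (S : Set G) :
    TwoSidedIdeal A :=
  .mk' {a | ∃ x ∈ I, (∀ g ∉ S, h.coeff x g = 0) ∧ h.coeff x 1 = a}
    ⟨0, I.zero_mem, by simp, by simp⟩
    (by
      rintro _ _ ⟨x, hxI, hx, rfl⟩ ⟨y, hyI, hy, rfl⟩
      exact ⟨x + y, I.add_mem hxI hyI, fun g hg => by simp [hx g hg, hy g hg], by simp⟩)
    (by
      rintro _ ⟨x, hxI, hx, rfl⟩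
      exact ⟨-x, I.neg_mem hxI, fun g hg => by simp [hx g hg], by simp⟩)
    (by
      rintro a _ ⟨x, hxI, hx, rfl⟩
      exact ⟨ι a * x, I.mul_mem_left _ _ hxI, fun g hg => by simp [coeff_ι_mul, hx g hg],
        by simp [coeff_ι_mul]⟩)
    (by
      rintro _ a ⟨x, hxI, hx, rfl⟩
      exact ⟨x * ι a, I.mul_mem_right _ _ hxI, fun g hg => by simp [coeff_mul_ι, hx g hg],
        by simp [coeff_mul_ι]⟩)

theorem mem_coeffIdeal (h : IsSkewGroupRing σ ι u) {I : TwoSidedIdeal R} {S : Set G} {a : A} :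
    a ∈ h.coeffIdeal I S ↔ ∃ x ∈ I, (∀ g ∉ S, h.coeff x g = 0) ∧ h.coeff x 1 = a := by
  simp [coeffIdeal]

theorem map_mem_coeffIdeal (h : IsSkewGroupRing σ ι u) {I : TwoSidedIdeal R} {S : Set G}
    (g : G) (a : A) (ha : a ∈ h.coeffIdeal I S) : σ g a ∈ h.coeffIdeal I S := by
  rw [mem_coeffIdeal] at ha ⊢
  obtain ⟨x, hxI, hx, rfl⟩ := ha
  exact ⟨u g * x * u g⁻¹, I.mul_mem_right _ _ (I.mul_mem_left _ _ hxI),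
    fun k hk => by simp [coeff_conj, hx k hk], coeff_conj h g x 1⟩

end CommGroup

end IsSkewGroupRing

/-- **Proposition 4.2.** Let `R = A ⋊_σ G` be a skew group ring with `G` abelian and `A`
`G`-simple. Then every non-zero two-sided ideal `I` of `R` contains a (non-zero) element of
`Z(R) ∩ (1 + ∑_{g ≠ e} A u_g)`, i.e. a central element whose coefficient at the neutral
element of `G` is `1`. In particular `Z(R)` has the ideal intersection property in `R`. -/
theorem center_ideal_intersection {A G R : Type*} [Ring A] [CommGroup G] [Ring R]
    (σ : G →* RingAut A) (ι : A →+* R) (u : G → R)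
    (h : IsSkewGroupRing σ ι u) (hGsimple : IsGSimple σ)
    (I : TwoSidedIdeal R) (hI : I ≠ ⊥) :
    ∃ z : R, z ∈ I ∧ z ∈ Subring.center R ∧ z ≠ 0 ∧
      ∃ f : G →₀ A, f 1 = 1 ∧ z = f.sum fun g a => ι a * u g := by
  obtain ⟨r, hrI, hr, hmin⟩ := h.exists_minimal_support hI
  have eq_zero {x : R} (hxI : x ∈ I) (hx : ∀ g, h.coeff r g = 0 → h.coeff x g = 0)
      (hx1 : h.coeff x 1 = 0) : x = 0 := by
    by_contra hx0
    refine (hmin x hxI hx0).not_gt (Finset.card_lt_card ?_)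
    refine Finset.ssubset_iff_of_subset (fun g hg => ?_) |>.2 ⟨1, by simpa using hr, by simpa⟩
    rw [Finsupp.mem_support_iff] at hg ⊢
    exact mt (hx g) hg
  have hr_mem : h.coeff r 1 ∈ h.coeffIdeal I {g | h.coeff r g ≠ 0} :=
    h.mem_coeffIdeal.2 ⟨r, hrI, by simp, rfl⟩
  have htop : h.coeffIdeal I {g | h.coeff r g ≠ 0} = ⊤ := by
    refine (hGsimple _ h.map_mem_coeffIdeal).resolve_left fun hbot => hr ?_
    rwa [hbot, TwoSidedIdeal.mem_bot] at hr_mem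
  have one_mem : (1 : A) ∈ h.coeffIdeal I {g | h.coeff r g ≠ 0} := htop ▸ trivial
  obtain ⟨z, hzI, hz, hz1⟩ := h.mem_coeffIdeal.1 one_mem
  simp only [Set.mem_ofPred_eq, not_not] at hz
  refine ⟨z, hzI, h.mem_center (fun a => ?_) (fun g => ?_), ?_, h.coeff z, hz1,
    (h.ofCoeff_coeff z).symm⟩
  · refine sub_eq_zero.1 (eq_zero (I.sub_mem (I.mul_mem_left _ _ hzI) (I.mul_mem_right _ _ hzI))
      (fun g hg => ?_) ?_)
    · simp [h.coeff_ι_mul, h.coeff_mul_ι, hz g hg]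
    · simp [h.coeff_ι_mul, h.coeff_mul_ι, hz1]
  · have hconj : u g * z * u g⁻¹ = z := by
      refine sub_eq_zero.1 (eq_zero
        (I.sub_mem (I.mul_mem_right _ _ (I.mul_mem_left _ _ hzI)) hzI) (fun k hk => ?_) ?_)
      · simp [h.coeff_conj, hz k hk]
      · simp [h.coeff_conj, hz1]
    calc u g * z = u g * z * (u g⁻¹ * u g) := by
          rw [h.u_mul, inv_mul_cancel, h.u_one, mul_one]
      _ = z * u g := by rw [← mul_assoc, hconj]
  · rintro rfl
    refine hr ?_
    rw [← mul_one (h.coeff r 1), ← hz1]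
    simp
end

section
/- Let R = A ⋊_σ G be a skew group ring where G is an abelian group and A is a commutative G-simple ring, and let K = ker(σ) be the kernel of σ : G → Aut(A). Then the centralizer of A in R equals A ⋊_σ K, the subring of R consisting of all elements with support contained in K. -/
/-- In a `G`-simple commutative ring with `G` abelian, an element `σ g` whose displacements
`σ g a - a` are all annihilated by a common nonzero element is the identity. -/
theorem IsGSimple.mem_ker_of_mul_eq {A G : Type*} [CommRing A] [CommGroup G]
    {σ : G →* RingAut A} (hσ : IsGSimple σ) {g : G} {x : A} (hx : x ≠ 0)
    (hxg : ∀ a, a * x = x * σ g a) : g ∈ σ.ker := by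
  let J : TwoSidedIdeal A := .mk' {y | ∀ a, a * y = y * σ g a}
    (fun a => by simp)
    (fun {y z} hy hz a => by rw [mul_add, add_mul, hy, hz])
    (fun {y} hy a => by rw [mul_neg, neg_mul, hy])
    (fun {y z} hz a => by rw [mul_left_comm, hz, mul_assoc])
    (fun {y z} hy a => by rw [← mul_assoc, hy, mul_right_comm])
  have mem_J (y : A) : y ∈ J ↔ ∀ a, a * y = y * σ g a := TwoSidedIdeal.mem_mk' ..
  have hJ : J = ⊥ ∨ J = ⊤ := by
    refine hσ J fun k y hy => (mem_J _).2 fun a => ?_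
    obtain ⟨b, rfl⟩ := (σ k).surjective a
    have comm : σ g (σ k b) = σ k (σ g b) := by
      rw [← RingAut.mul_apply, ← RingAut.mul_apply, ← map_mul, ← map_mul, mul_comm]
    rw [comm, ← map_mul, ← map_mul, (mem_J y).1 hy]
  have hxJ : x ∈ J := (mem_J x).2 hxg
  rcases hJ with hJ | hJ
  · rw [hJ, TwoSidedIdeal.mem_bot] at hxJ
    exact absurd hxJ hx
  · have one_mem : (1 : A) ∈ J := by rw [hJ]; trivial
    rw [MonoidHom.mem_ker]
    ext a
    simpa using ((mem_J 1).1 one_mem a).symm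

namespace IsSkewGroupRing

theorem mul_sum {A G R : Type*} [Ring A] [Ring R] {ι : A →+* R} {u : G → R}
    (a : A) (f : G →₀ A) :
    ι a * (f.sum fun g b => ι b * u g) = f.sum fun g b => ι (a * b) * u g := by
  simp only [Finsupp.mul_sum, map_mul, mul_assoc]

variable {A G R : Type*} [Ring A] [Group G] [Ring R]
  {σ : G →* RingAut A} {ι : A →+* R} {u : G → R}

theorem sum_mul (h : IsSkewGroupRing σ ι u) (a : A) (f : G →₀ A) :
    (f.sum fun g b => ι b * u g) * ι a = f.sum fun g b => ι (b * σ g a) * u g := by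
  simp only [Finsupp.sum_mul, map_mul, mul_assoc, h.2.2.1]

/-- An element commutes with `a` if and only if its coefficients satisfy
`a * f g = f g * σ g a`. -/
theorem mul_sum_eq_sum_mul_iff (h : IsSkewGroupRing σ ι u) (a : A) (f : G →₀ A) :
    ι a * (f.sum fun g b => ι b * u g) = (f.sum fun g b => ι b * u g) * ι a ↔
      ∀ g, a * f g = f g * σ g a := by
  rw [mul_sum, h.sum_mul]
  constructor
  · intro heq g
    let p : G →₀ A := Finsupp.onFinset f.support (fun g => a * f g)
      fun g hg => Finsupp.mem_support_iff.2 (right_ne_zero_of_mul hg)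
    let q : G →₀ A := Finsupp.onFinset f.support (fun g => f g * σ g a)
      fun g hg => Finsupp.mem_support_iff.2 (left_ne_zero_of_mul hg)
    have hp : (p.sum fun g b => ι b * u g) = f.sum fun g b => ι (a * b) * u g :=
      Finsupp.onFinset_sum _ (by simp)
    have hq : (q.sum fun g b => ι b * u g) = f.sum fun g b => ι (b * σ g a) * u g :=
      Finsupp.onFinset_sum _ (by simp)
    have hpq : p = q := (h.2.2.2 _).unique hp.symm (heq.trans hq.symm)
    exact DFunLike.congr_fun hpq g
  · intro hf
    exact Finsupp.sum_congr fun g _ => by rw [hf g]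

end IsSkewGroupRing

/-- **Proposition 5.1 (first part).** Let `R = A ⋊_σ G` be a skew group ring where `G` is
abelian and `A` is commutative and `G`-simple, and let `K = ker σ`. Then the centralizer
of `A` (identified with `A·u_e`) in `R` equals `A ⋊_σ K`, the subring of elements whose
support is contained in `K`. -/
theorem centralizer_eq_skew_group_ring_of_kernel {A G R : Type*} [CommRing A] [CommGroup G]
    [Ring R] (σ : G →* RingAut A) (ι : A →+* R) (u : G → R)
    (h : IsSkewGroupRing σ ι u) (hGsimple : IsGSimple σ) :
    (Subring.centralizer (Set.range ι) : Set R) =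
      {r : R | ∃ f : G →₀ A, (∀ g ∈ f.support, g ∈ σ.ker) ∧
        r = f.sum fun g a => ι a * u g} := by
  ext r
  simp only [SetLike.mem_coe, Subring.mem_centralizer_iff, Set.forall_mem_range,
    Set.mem_ofPred_eq]
  constructor
  · intro hr
    obtain ⟨f, rfl, -⟩ := h.2.2.2 r
    refine ⟨f, fun g hg => ?_, rfl⟩
    exact hGsimple.mem_ker_of_mul_eq (Finsupp.mem_support_iff.1 hg)
      fun a => (h.mul_sum_eq_sum_mul_iff a f).1 (hr a) g
  · rintro ⟨f, hf, rfl⟩ a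
    refine (h.mul_sum_eq_sum_mul_iff a f).2 fun g => ?_
    by_cases hg : g ∈ f.support
    · rw [MonoidHom.mem_ker.1 (hf g hg), RingAut.one_apply, mul_comm]
    · simp [Finsupp.notMem_support_iff.1 hg]
end

section
/- Let A = M_2(ℝ) be the ring of 2×2 real matrices, G = ℤ/2ℤ, M the matrix with rows (0,1) and (−1,0) (so M² = −I), and σ : G → Aut(A) defined by σ_0 = id_A and σ_1(a) = M a M^{-1}. Then the skew group ring A ⋊_σ G is a simple ring (even though the action of G is inner). -/
/-- A ring hom `ι` from real matrices, together with an element `v` commuting with its image and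
satisfying `v * v = -1`, extends to complex matrices by sending `i` to `v`. -/
noncomputable def complexMatrixLift {n R : Type*} [Fintype n] [DecidableEq n] [Ring R]
    (ι : Matrix n n ℝ →+* R) (v : R) (hv : v * v = -1) (hc : ∀ a, v * ι a = ι a * v) :
    Matrix n n ℂ →+* R where
  toFun X := ι (X.map Complex.re) + ι (X.map Complex.im) * v
  map_one' := by
    have hre : (1 : Matrix n n ℂ).map Complex.re = 1 := by
      ext i j
      by_cases hij : i = j <;> simp [Matrix.one_apply, hij]
    have him : (1 : Matrix n n ℂ).map Complex.im = 0 := by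
      ext i j
      by_cases hij : i = j <;> simp [hij]
    rw [hre, him, map_one, map_zero, zero_mul, add_zero]
  map_zero' := by
    have hre : (0 : Matrix n n ℂ).map Complex.re = 0 := by ext; simp
    have him : (0 : Matrix n n ℂ).map Complex.im = 0 := by ext; simp
    rw [hre, him, map_zero, zero_mul, add_zero]
  map_add' X Y := by
    have hre : (X + Y).map Complex.re = X.map Complex.re + Y.map Complex.re := by ext; simp
    have him : (X + Y).map Complex.im = X.map Complex.im + Y.map Complex.im := by ext; simp
    rw [hre, him, map_add, map_add]
    noncomm_ring
  map_mul' X Y := by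
    have hre : (X * Y).map Complex.re =
        X.map Complex.re * Y.map Complex.re - X.map Complex.im * Y.map Complex.im := by
      ext
      simp [Matrix.mul_apply]
    have him : (X * Y).map Complex.im =
        X.map Complex.re * Y.map Complex.im + X.map Complex.im * Y.map Complex.re := by
      ext
      simp [Matrix.mul_apply, Finset.sum_add_distrib]
    rw [hre, him]
    generalize X.map Complex.re = a
    generalize X.map Complex.im = b
    generalize Y.map Complex.re = c
    generalize Y.map Complex.im = d
    have hbd : ι b * v * (ι d * v) = -(ι b * ι d) := by
      rw [mul_assoc, ← mul_assoc v, hc, mul_assoc, hv, mul_neg_one, mul_neg]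
    have hbc : ι b * v * ι c = ι b * ι c * v := by rw [mul_assoc, hc, mul_assoc]
    rw [add_mul, mul_add, mul_add, hbd, hbc, map_sub, map_add, map_mul, map_mul, map_mul, map_mul]
    noncomm_ring

theorem complexMatrixLift_apply {n R : Type*} [Fintype n] [DecidableEq n] [Ring R]
    (ι : Matrix n n ℝ →+* R) (v : R) (hv : v * v = -1) (hc : ∀ a, v * ι a = ι a * v)
    (X : Matrix n n ℂ) :
    complexMatrixLift ι v hv hc X = ι (X.map Complex.re) + ι (X.map Complex.im) * v :=
  rfl

/-- A skew group ring over a nontrivial ring is nontrivial. -/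
theorem IsSkewGroupRing.nontrivial {A G R : Type*} [Ring A] [Nontrivial A] [Group G] [Ring R]
    {σ : G →* RingAut A} {ι : A →+* R} {u : G → R} (h : IsSkewGroupRing σ ι u) :
    Nontrivial R := by
  by_contra hR
  rw [not_nontrivial_iff_subsingleton] at hR
  obtain ⟨f, -, hf⟩ := h.2.2.2 0
  have heq := (hf 0 (Subsingleton.elim _ _)).trans
    (hf (Finsupp.single 1 1) (Subsingleton.elim _ _)).symm
  simpa using DFunLike.congr_fun heq 1

/-- **Example 4.4.** Let `A = M₂(ℝ)`, `G = ℤ/2ℤ`, `M = [[0,1],[-1,0]]` (so `M² = -I`) and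
let `σ : G → Aut(A)` be given by `σ 0 = id` and `σ 1 = conjugation by M` (an inner
action). Then the skew group ring `A ⋊_σ G` is simple. -/
theorem inner_example_simple {R : Type*} [Ring R]
    (σ : Multiplicative (ZMod 2) →* RingAut (Matrix (Fin 2) (Fin 2) ℝ))
    (hσ : ∀ a : Matrix (Fin 2) (Fin 2) ℝ,
      σ (Multiplicative.ofAdd 1) a = !![0, 1; -1, 0] * a * (!![0, 1; -1, 0])⁻¹)
    (ι : Matrix (Fin 2) (Fin 2) ℝ →+* R) (u : Multiplicative (ZMod 2) → R)
    (h : IsSkewGroupRing σ ι u) :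
    IsSimpleRing R := by
  obtain ⟨u_one, u_mul, u_comm, u_basis⟩ := id h
  have : Nontrivial R := h.nontrivial
  set M : Matrix (Fin 2) (Fin 2) ℝ := !![0, 1; -1, 0] with hM
  set g : Multiplicative (ZMod 2) := Multiplicative.ofAdd 1 with hg
  have hMM : M * M = -1 := by
    ext i j
    fin_cases i <;> fin_cases j <;> simp [hM]
  have hMinv : M⁻¹ = -M := Matrix.inv_eq_right_inv (by rw [mul_neg, hMM, neg_neg])
  have hMσ (a : Matrix (Fin 2) (Fin 2) ℝ) : M * σ g a = a * M := by
    rw [hσ, hMinv, mul_assoc, ← mul_assoc M M, hMM, neg_one_mul, mul_neg, neg_neg]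
  have huu : u g * u g = 1 := by
    have hgg : g * g = 1 := by rw [hg]; decide
    rw [u_mul, hgg, u_one]
  have hc (a : Matrix (Fin 2) (Fin 2) ℝ) : ι M * u g * ι a = ι a * (ι M * u g) := by
    rw [mul_assoc, u_comm, ← mul_assoc, ← mul_assoc, ← map_mul, ← map_mul, hMσ]
  have hv : ι M * u g * (ι M * u g) = -1 := by
    rw [← mul_assoc, hc, mul_assoc, mul_assoc, huu, mul_one, ← map_mul, hMM, map_neg, map_one]
  refine IsSimpleRing.of_surjective (complexMatrixLift ι (ι M * u g) hv hc) inferInstance ?_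
  rw [← RingHom.range_eq_top, eq_top_iff]
  rintro r -
  obtain ⟨f, rfl, -⟩ := u_basis r
  refine sum_mem fun k _ => ?_
  have hG : ∀ k : Multiplicative (ZMod 2), k = 1 ∨ k = Multiplicative.ofAdd 1 := by decide
  change ι (f k) * u k ∈ _
  rcases hG k with rfl | rfl
  · refine ⟨(f 1).map fun x => ⟨x, 0⟩, ?_⟩
    have hre : ((f 1).map fun x => (⟨x, 0⟩ : ℂ)).map Complex.re = f 1 := by ext; simp
    have him : ((f 1).map fun x => (⟨x, 0⟩ : ℂ)).map Complex.im = 0 := by ext; simp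
    rw [complexMatrixLift_apply, hre, him, map_zero, zero_mul, add_zero, u_one, mul_one]
  · refine ⟨(-(f g * M)).map fun x => ⟨0, x⟩, ?_⟩
    have hre : ((-(f g * M)).map fun x => (⟨0, x⟩ : ℂ)).map Complex.re = 0 := by ext; simp
    have him : ((-(f g * M)).map fun x => (⟨0, x⟩ : ℂ)).map Complex.im = -(f g * M) := by
      ext; simp
    rw [complexMatrixLift_apply, hre, him, map_zero, zero_add, ← mul_assoc, ← map_mul, neg_mul,
      mul_assoc, hMM, mul_neg_one, neg_neg]
end

section
/- Let G be a group acting faithfully on a set X (for each g ∈ G ∖ {e} there exists x ∈ X with g.x ≠ x). If for any two distinct points x, y ∈ X the set Stab_G(x).y = {h.y | h ∈ G, h.x = x} is infinite, then G is an ICC group. -/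
/-- **Lemma 6.7.** Let `G` be a group acting faithfully on a set `X`. If for any two
distinct `x, y ∈ X` the set `Stab_G(x).y` is infinite, then `G` is an ICC group. -/
theorem icc_of_infinite_stabilizer_orbits {G X : Type*} [Group G] [MulAction G X]
    (hfaithful : ∀ g : G, g ≠ 1 → ∃ x : X, g • x ≠ x)
    (hstab : ∀ x y : X, x ≠ y → {z : X | ∃ h : G, h • x = x ∧ z = h • y}.Infinite) :
    ∀ g : G, g ≠ 1 → {k : G | ∃ h : G, k = h * g * h⁻¹}.Infinite := by
  intro g hg
  obtain ⟨x, hx⟩ := hfaithful g hg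
  refine Set.Infinite.of_image (fun k : G => k • x) ((hstab x (g • x) hx.symm).mono ?_)
  rintro _ ⟨h, hh, rfl⟩
  refine ⟨h * g * h⁻¹, ⟨h, rfl⟩, ?_⟩
  simp only [mul_smul, inv_smul_eq_iff.mpr hh.symm]
end

section
/- The group Homeo(S¹) of all homeomorphisms of the circle S¹ (under composition) is an ICC group. -/
/-- The group of self-homeomorphisms of a topological space, under composition
(`(g * h) x = g (h x)`). -/
instance homeoGroup (X : Type*) [TopologicalSpace X] : Group (X ≃ₜ X) where
  mul g h := h.trans g
  one := Homeomorph.refl X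
  inv := Homeomorph.symm
  mul_assoc _ _ _ := Homeomorph.ext fun _ => rfl
  one_mul _ := Homeomorph.ext fun _ => rfl
  mul_one _ := Homeomorph.ext fun _ => rfl
  inv_mul_cancel g := Homeomorph.ext g.symm_apply_apply

/-- The circle is homeomorphic to the one-point compactification of the line, with the point at
infinity sent to any prescribed point. -/
theorem Circle.exists_homeomorph_onePoint_infty (x : Circle) :
    ∃ e : OnePoint ℝ ≃ₜ Circle, e OnePoint.infty = x := by
  have : Fact (Module.finrank ℝ ℂ = 1 + 1) := ⟨Complex.finrank_real_complex⟩
  have hrank : Module.finrank ℝ ℝ = Module.finrank ℝ (Submodule.span ℝ {(1 : ℂ)})ᗮ := by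
    rw [Module.finrank_self, Submodule.finrank_orthogonal_span_singleton (n := 1) one_ne_zero]
  let l := (FiniteDimensional.nonempty_continuousLinearEquiv_of_finrank_eq hrank).some
  let e : OnePoint ℝ ≃ₜ Circle := l.toHomeomorph.onePointCongr.trans
    (onePointHyperplaneHomeoUnitSphere (norm_one (α := ℂ)))
  exact ⟨e.trans (Homeomorph.mulLeft (x * (e OnePoint.infty)⁻¹)), by simp⟩

/-- The stabilizer of a point of the circle in its homeomorphism group has infinite orbits on the
complement of that point. -/
theorem Circle.infinite_orbit_of_fixing {x y : Circle} (hxy : y ≠ x) :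
    {z : Circle | ∃ h : Circle ≃ₜ Circle, h x = x ∧ h y = z}.Infinite := by
  obtain ⟨e, rfl⟩ := Circle.exists_homeomorph_onePoint_infty x
  obtain ⟨p, rfl⟩ := e.surjective y
  obtain ⟨t, rfl⟩ := OnePoint.ne_infty_iff_exists.mp (ne_of_apply_ne e hxy)
  refine Set.infinite_of_injective_forall_mem (α := ℝ) (f := fun s => e ((s + t : ℝ) : OnePoint ℝ))
    (fun a b hab => by simpa using hab) fun s => ?_
  refine ⟨(e.symm.trans (Homeomorph.addLeft s).onePointCongr).trans e, ?_, ?_⟩ <;>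
    simp [Homeomorph.onePointCongr]

/-- **Proposition 6.8.** `Homeo(S¹)`, the group of all homeomorphisms of the circle `S¹`,
is an ICC group: every non-identity element has an infinite conjugacy class. -/
theorem homeoCircle_icc :
    ∀ g : Circle ≃ₜ Circle, g ≠ 1 →
      {k : Circle ≃ₜ Circle | ∃ h : Circle ≃ₜ Circle, k = h * g * h⁻¹}.Infinite := by
  intro g hg
  obtain ⟨x, hx⟩ : ∃ x, g x ≠ x := by
    by_contra! H
    exact hg (Homeomorph.ext H)
  refine Set.Infinite.of_image (fun k : Circle ≃ₜ Circle => k x)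
    ((Circle.infinite_orbit_of_fixing hx).mono ?_)
  rintro _ ⟨h, hfix, rfl⟩
  exact ⟨_, ⟨h, rfl⟩, congrArg (fun z => h (g z)) (h.symm_apply_eq.mpr hfix.symm)⟩
end
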